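/- Single-letterization in the Gelfand–Pinsker converse: let n be a positive integer and let W, S₁,...,Sₙ, Y₁,...,Yₙ be random variables with values in finite sets such that for each i ∈ {1,...,n}, Sᵢ is independent of S_{i+1}^n = (S_{i+1},...,Sₙ). Then I(W; Y^n) − I(W; S^n) ≤ Σ_{i=1}^n [ I(Uᵢ; Yᵢ) − I(Uᵢ; Sᵢ) ], where Uᵢ = (W, Y^{i−1}, S_{i+1}^n). -/

import Mathlib

open scoped Classical

/-- The probability of the event `f = a` under the pmf `P` on a finite space. -/
noncomputable def pr {Ω A : Type*} [Fintype Ω] (P : Ω → ℝ) (f : Ω → A) (a : A) : ℝ :=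
  ∑ ω, if f ω = a then P ω else 0

/-- Shannon entropy `H(f)` (convention `0 log 0 = 0`, automatic since `Real.log 0 = 0`). -/
noncomputable def ent {Ω A : Type*} [Fintype Ω] [Fintype A] (P : Ω → ℝ) (f : Ω → A) : ℝ :=
  -∑ a, pr P f a * Real.log (pr P f a)

/-- Mutual information `I(f;g) = H(f) + H(g) − H(f,g)`. -/
noncomputable def mi {Ω A B : Type*} [Fintype Ω] [Fintype A] [Fintype B]
    (P : Ω → ℝ) (f : Ω → A) (g : Ω → B) : ℝ :=
  ent P f + ent P g - ent P (fun ω => (f ω, g ω))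

/-- Conditional mutual information `I(f;g|h) = H(f,h) + H(g,h) − H(f,g,h) − H(h)`. -/
noncomputable def cmi {Ω A B C : Type*} [Fintype Ω] [Fintype A] [Fintype B] [Fintype C]
    (P : Ω → ℝ) (f : Ω → A) (g : Ω → B) (h : Ω → C) : ℝ :=
  ent P (fun ω => (f ω, h ω)) + ent P (fun ω => (g ω, h ω)) -
    ent P (fun ω => (f ω, g ω, h ω)) - ent P h

/-- The prefix tuple `A^{i-1} = (A₁, …, A_{i−1})` of a finite sequence of random
variables (as a single random variable). -/
def pre {Ω A : Type*} {n : ℕ} (f : Fin n → Ω → A) (i : Fin n) :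
    Ω → (Fin i.val → A) :=
  fun ω j => f ⟨j.val, j.isLt.trans i.isLt⟩ ω

/-- The suffix tuple `A_{i+1}^n = (A_{i+1}, …, A_n)` of a finite sequence of random
variables (as a single random variable). -/
def suf {Ω A : Type*} {n : ℕ} (f : Fin n → Ω → A) (i : Fin n) :
    Ω → (Fin (n - (i.val + 1)) → A) :=
  fun ω j => f ⟨i.val + 1 + j.val, by have h1 := j.isLt; have h2 := i.isLt; omega⟩ ω

/-- Independence of two random variables on a finite pmf space. -/
def IndepRV {Ω A B : Type*} [Fintype Ω]
    (P : Ω → ℝ) (f : Ω → A) (g : Ω → B) : Prop :=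
  ∀ a b, pr P (fun ω => (f ω, g ω)) (a, b) = pr P f a * pr P g b

/-- Conditional independence of `f` and `g` given `h` on a finite pmf space. -/
def CondIndepRV {Ω A B C : Type*} [Fintype Ω]
    (P : Ω → ℝ) (f : Ω → A) (g : Ω → B) (h : Ω → C) : Prop :=
  ∀ a b c,
    pr P (fun ω => (f ω, g ω, h ω)) (a, b, c) * pr P h c =
      pr P (fun ω => (f ω, h ω)) (a, c) * pr P (fun ω => (g ω, h ω)) (b, c)

lemma pr_apply_self_pos {Ω A : Type*} [Fintype Ω] {P : Ω → ℝ} (hP0 : ∀ ω, 0 ≤ P ω)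
    (f : Ω → A) {ω : Ω} (hω : 0 < P ω) : 0 < pr P f (f ω) := by
  refine Finset.sum_pos' (fun x _ => ?_) ⟨ω, Finset.mem_univ ω, by simpa using hω⟩
  split_ifs
  exacts [hP0 x, le_rfl]

lemma pr_nonneg {Ω A : Type*} [Fintype Ω] {P : Ω → ℝ} (hP0 : ∀ ω, 0 ≤ P ω)
    (f : Ω → A) (a : A) : 0 ≤ pr P f a := by
  refine Finset.sum_nonneg fun x _ => ?_
  split_ifs
  exacts [hP0 x, le_rfl]

lemma sum_pr_mul {Ω A : Type*} [Fintype Ω] [Fintype A] (P : Ω → ℝ) (f : Ω → A) (φ : A → ℝ) :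
    ∑ a, pr P f a * φ a = ∑ ω, P ω * φ (f ω) := by
  simp only [pr, Finset.sum_mul]
  rw [Finset.sum_comm]
  refine Finset.sum_congr rfl fun ω _ => ?_
  simp [ite_mul]

lemma sum_pr {Ω A : Type*} [Fintype Ω] [Fintype A] (P : Ω → ℝ) (f : Ω → A) :
    ∑ a, pr P f a = ∑ ω, P ω := by
  simpa using sum_pr_mul P f (fun _ => 1)

lemma ent_eq_neg_sum {Ω A : Type*} [Fintype Ω] [Fintype A] (P : Ω → ℝ) (f : Ω → A) :
    ent P f = -∑ ω, P ω * Real.log (pr P f (f ω)) := by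
  rw [ent, sum_pr_mul P f fun a => Real.log (pr P f a)]

/-- Entropy depends only on the partition of the sample space induced by the variable. -/
lemma ent_congr {Ω A B : Type*} [Fintype Ω] [Fintype A] [Fintype B] (P : Ω → ℝ)
    {f : Ω → A} {g : Ω → B} (h : ∀ x y, f x = f y ↔ g x = g y) : ent P f = ent P g := by
  simp only [ent_eq_neg_sum, pr, h]

lemma ent_eq_zero_of_forall_eq {Ω A : Type*} [Fintype Ω] [Fintype A] {P : Ω → ℝ}
    (hP1 : ∑ ω, P ω = 1) {f : Ω → A} (h : ∀ x y, f x = f y) : ent P f = 0 := by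
  rw [ent_eq_neg_sum]
  simp [pr, fun x y => eq_true (h x y), hP1]

lemma IndepRV.ent_prod {Ω A B : Type*} [Fintype Ω] [Fintype A] [Fintype B] {P : Ω → ℝ}
    (hP0 : ∀ ω, 0 ≤ P ω) {f : Ω → A} {g : Ω → B} (h : IndepRV P f g) :
    ent P (fun ω => (f ω, g ω)) = ent P f + ent P g := by
  simp only [ent_eq_neg_sum]
  rw [← neg_add, ← Finset.sum_add_distrib]
  congr 1
  refine Finset.sum_congr rfl fun ω _ => ?_
  rcases (hP0 ω).eq_or_lt with h0 | h0
  · simp [← h0]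
  · rw [h, Real.log_mul (pr_apply_self_pos hP0 f h0).ne' (pr_apply_self_pos hP0 g h0).ne', mul_add]

lemma ent_prod_le {Ω A B : Type*} [Fintype Ω] [Fintype A] [Fintype B] {P : Ω → ℝ}
    (hP0 : ∀ ω, 0 ≤ P ω) (hP1 : ∑ ω, P ω = 1) (f : Ω → A) (g : Ω → B) :
    ent P (fun ω => (f ω, g ω)) ≤ ent P f + ent P g := by
  set q : A × B → ℝ := pr P (fun ω => (f ω, g ω)) with hq
  set r : A × B → ℝ := fun c => pr P f c.1 * pr P g c.2 with hr
  have hr0 : ∀ c, 0 ≤ r c := fun c => mul_nonneg (pr_nonneg hP0 f _) (pr_nonneg hP0 g _)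
  have hsum : ∑ ω, P ω * (r (f ω, g ω) / q (f ω, g ω)) ≤ 1 := by
    rw [← sum_pr_mul P (fun ω => (f ω, g ω)) (fun c => r c / q c)]
    calc ∑ c, q c * (r c / q c) ≤ ∑ c, r c := by
          refine Finset.sum_le_sum fun c _ => ?_
          rcases eq_or_ne (q c) 0 with h0 | h0
          · simpa [h0] using hr0 c
          · exact (mul_div_cancel₀ _ h0).le
      _ = 1 := by
          rw [Fintype.sum_prod_type, ← Finset.sum_mul_sum, sum_pr, sum_pr, hP1, one_mul]
  have hpt : ∀ ω, P ω * Real.log (pr P f (f ω)) + P ω * Real.log (pr P g (g ω))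
      - P ω * Real.log (q (f ω, g ω)) ≤ P ω * (r (f ω, g ω) / q (f ω, g ω)) - P ω := by
    intro ω
    rcases (hP0 ω).eq_or_lt with h0 | h0
    · simp [← h0]
    · have hf := pr_apply_self_pos hP0 f h0
      have hg := pr_apply_self_pos hP0 g h0
      have hfg : 0 < q (f ω, g ω) := pr_apply_self_pos hP0 (fun ω => (f ω, g ω)) h0
      have hlog := Real.log_le_sub_one_of_pos (div_pos (mul_pos hf hg) hfg)
      rw [Real.log_div (mul_pos hf hg).ne' hfg.ne', Real.log_mul hf.ne' hg.ne'] at hlog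
      linarith [mul_le_mul_of_nonneg_left hlog h0.le]
  have hle := Finset.sum_le_sum fun ω (_ : ω ∈ Finset.univ) => hpt ω
  simp only [Finset.sum_sub_distrib, Finset.sum_add_distrib, hP1] at hle
  simp only [ent_eq_neg_sum]
  linarith

/-- The first `k` terms of a finite sequence of random variables. -/
def initial {Ω A : Type*} {n : ℕ} (f : Fin n → Ω → A) (k : ℕ) :
    Ω → ({j : Fin n // j.val < k} → A) :=
  fun ω j => f j ω

/-- The terms of index at least `k` of a finite sequence of random variables. -/
def final {Ω A : Type*} {n : ℕ} (f : Fin n → Ω → A) (k : ℕ) :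
    Ω → ({j : Fin n // k ≤ j.val} → A) :=
  fun ω j => f j ω

section Tuples

variable {Ω A : Type*} {n : ℕ} (f : Fin n → Ω → A) (x y : Ω)

lemma initial_eq_iff (k : ℕ) :
    initial f k x = initial f k y ↔ ∀ j : Fin n, j.val < k → f j x = f j y := by
  simp [initial, funext_iff]

lemma final_eq_iff (k : ℕ) :
    final f k x = final f k y ↔ ∀ j : Fin n, k ≤ j.val → f j x = f j y := by
  simp [final, funext_iff]

lemma pre_eq_iff (i : Fin n) : pre f i x = pre f i y ↔ initial f i x = initial f i y := by
  rw [initial_eq_iff]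
  exact ⟨fun h j hj => congrFun h ⟨j, hj⟩, fun h => funext fun j => h _ j.isLt⟩

lemma suf_eq_iff (i : Fin n) : suf f i x = suf f i y ↔ final f (i + 1) x = final f (i + 1) y := by
  rw [final_eq_iff]
  refine ⟨fun h j hj => ?_, fun h => funext fun j => h _ (Nat.le_add_right _ _)⟩
  have hj' := congrFun h ⟨j.val - (i.val + 1), by omega⟩
  have e : (⟨i.val + 1 + (j.val - (i.val + 1)), by omega⟩ : Fin n) = j := by
    ext
    simp only
    omega
  simpa only [suf, e] using hj'

lemma initial_succ_eq_iff (i : Fin n) :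
    initial f (i + 1) x = initial f (i + 1) y ↔
      initial f i x = initial f i y ∧ f i x = f i y := by
  simp only [initial_eq_iff]
  refine ⟨fun h => ⟨fun j hj => h j (by omega), h i (by omega)⟩, fun h j hj => ?_⟩
  rcases Nat.lt_succ_iff_lt_or_eq.mp hj with hj | hj
  · exact h.1 j hj
  · rw [Fin.ext hj]
    exact h.2

lemma final_eq_iff_succ (i : Fin n) :
    final f i x = final f i y ↔ f i x = f i y ∧ final f (i + 1) x = final f (i + 1) y := by
  simp only [final_eq_iff]
  refine ⟨fun h => ⟨h i le_rfl, fun j hj => h j (by omega)⟩, fun h j hj => ?_⟩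
  rcases hj.eq_or_lt with hj | hj
  · rw [← Fin.ext hj]
    exact h.1
  · exact h.2 j hj

end Tuples

lemma Fin.sum_univ_sub_succ {n : ℕ} (g : ℕ → ℝ) :
    ∑ i : Fin n, (g (i + 1) - g i) = g n - g 0 := by
  rw [Fin.sum_univ_eq_sum_range (fun k => g (k + 1) - g k) n, Finset.sum_range_sub]

lemma ent_pi_le_sum {Ω A : Type*} [Fintype Ω] [Fintype A] {n : ℕ} {P : Ω → ℝ}
    (hP0 : ∀ ω, 0 ≤ P ω) (hP1 : ∑ ω, P ω = 1) (f : Fin n → Ω → A) :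
    ent P (fun ω i => f i ω) ≤ ∑ i, ent P (f i) := by
  have hstep : ∀ i : Fin n, ent P (initial f (i + 1)) - ent P (initial f i) ≤ ent P (f i) := by
    intro i
    have h1 : ent P (initial f (i + 1)) = ent P (fun ω => (initial f i ω, f i ω)) :=
      ent_congr P fun x y => by rw [initial_succ_eq_iff, Prod.mk.injEq]
    linarith [ent_prod_le hP0 hP1 (initial f i) (f i)]
  have hsum := Finset.sum_le_sum fun i (_ : i ∈ Finset.univ) => hstep i
  rw [Fin.sum_univ_sub_succ fun k => ent P (initial f k)] at hsum
  have h0 : ent P (initial f 0) = 0 :=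
    ent_eq_zero_of_forall_eq hP1 fun x y => by simp [initial_eq_iff]
  have hn : ent P (fun ω i => f i ω) = ent P (initial f n) :=
    ent_congr P fun x y => by simp [initial, funext_iff]
  linarith

lemma ent_pi_eq_sum {Ω A : Type*} [Fintype Ω] [Fintype A] {n : ℕ} {P : Ω → ℝ}
    (hP0 : ∀ ω, 0 ≤ P ω) (hP1 : ∑ ω, P ω = 1) (f : Fin n → Ω → A)
    (hind : ∀ i, IndepRV P (f i) (suf f i)) :
    ent P (fun ω i => f i ω) = ∑ i, ent P (f i) := by
  have hstep : ∀ i : Fin n, ent P (f i) = -(ent P (final f (i + 1)) - ent P (final f i)) := by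
    intro i
    have h1 : ent P (final f i) = ent P (fun ω => (f i ω, suf f i ω)) :=
      ent_congr P fun x y => by rw [final_eq_iff_succ, Prod.mk.injEq, suf_eq_iff]
    have h2 : ent P (suf f i) = ent P (final f (i + 1)) := ent_congr P fun x y => suf_eq_iff f x y i
    linarith [(hind i).ent_prod hP0]
  rw [Finset.sum_congr rfl fun i _ => hstep i, Finset.sum_neg_distrib,
    Fin.sum_univ_sub_succ fun k => ent P (final f k)]
  have h0 : ent P (final f n) = 0 :=
    ent_eq_zero_of_forall_eq hP1 fun x y =>
      (final_eq_iff f x y n).mpr fun j hj => absurd j.isLt hj.not_gt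
  have hn : ent P (fun ω i => f i ω) = ent P (final f 0) :=
    ent_congr P fun x y => by simp [final, funext_iff]
  linarith

/-- single-letterization in the Gelfand–Pinsker converse.  If each `Sᵢ`
is independent of the suffix `S_{i+1}^n`, then, with `Uᵢ = (W, Y^{i−1}, S_{i+1}^n)`,
`I(W;Y^n) − I(W;S^n) ≤ Σᵢ [ I(Uᵢ;Yᵢ) − I(Uᵢ;Sᵢ) ]`. -/
theorem GP_single_letterization {Ω Wt St Yt : Type*}
    [Fintype Ω] [Fintype Wt] [Fintype St] [Fintype Yt]
    {n : ℕ} (hn : 0 < n)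
    (P : Ω → ℝ) (hP0 : ∀ ω, 0 ≤ P ω) (hP1 : ∑ ω, P ω = 1)
    (W : Ω → Wt) (S : Fin n → Ω → St) (Y : Fin n → Ω → Yt)
    (hind : ∀ i : Fin n, IndepRV P (S i) (suf S i)) :
    mi P W (fun ω => fun i => Y i ω) - mi P W (fun ω => fun i => S i ω) ≤
      ∑ i : Fin n,
        (mi P (fun ω => (W ω, pre Y i ω, suf S i ω)) (Y i) -
          mi P (fun ω => (W ω, pre Y i ω, suf S i ω)) (S i)) := by
  have hstep : ∀ i : Fin n,
      mi P (fun ω => (W ω, pre Y i ω, suf S i ω)) (Y i) -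
          mi P (fun ω => (W ω, pre Y i ω, suf S i ω)) (S i) =
        ent P (Y i) - ent P (S i) -
          (ent P (fun ω => (W ω, initial Y (i + 1) ω, final S (i + 1) ω)) -
            ent P (fun ω => (W ω, initial Y i ω, final S i ω))) := by
    intro i
    have hY : ent P (fun ω => ((W ω, pre Y i ω, suf S i ω), Y i ω)) =
        ent P (fun ω => (W ω, initial Y (i + 1) ω, final S (i + 1) ω)) :=
      ent_congr P fun x y => by
        simp only [Prod.mk.injEq, pre_eq_iff, suf_eq_iff, initial_succ_eq_iff]
        tauto
    have hS : ent P (fun ω => ((W ω, pre Y i ω, suf S i ω), S i ω)) =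
        ent P (fun ω => (W ω, initial Y i ω, final S i ω)) :=
      ent_congr P fun x y => by
        simp only [Prod.mk.injEq, pre_eq_iff, suf_eq_iff, final_eq_iff_succ S x y i]
        tauto
    simp only [mi, hY, hS]
    ring
  rw [Finset.sum_congr rfl fun i _ => hstep i, Finset.sum_sub_distrib, Finset.sum_sub_distrib,
    Fin.sum_univ_sub_succ fun k => ent P (fun ω => (W ω, initial Y k ω, final S k ω))]
  have hn : ent P (fun ω => (W ω, fun i => Y i ω)) =
      ent P (fun ω => (W ω, initial Y n ω, final S n ω)) :=
    ent_congr P fun x y => by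
      have hlast : final S n x = final S n y :=
        (final_eq_iff S x y n).mpr fun j hj => absurd j.isLt hj.not_gt
      simp [initial, funext_iff, hlast]
  have h0 : ent P (fun ω => (W ω, fun i => S i ω)) =
      ent P (fun ω => (W ω, initial Y 0 ω, final S 0 ω)) :=
    ent_congr P fun x y => by simp [initial, final, funext_iff]
  have hYle := ent_pi_le_sum hP0 hP1 Y
  have hSeq := ent_pi_eq_sum hP0 hP1 S hind
  simp only [mi]
  linarith
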